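/- For every integer 1 ≤ s ≤ l, every α ∈ {z,+,−} and every u ∈ ℂ, the quantity Λ_α^{(s)}(u) = tr_{a_1…a_s}( (Σ_{j=1}^s σ^α_{a_j}/c_α) · T^{(s)}(u) ) (where σ^z/c_z = (1/2)diag(1,−1), σ^+/c_+ = E^{12}, σ^−/c_− = E^{21} act on the j-th auxiliary factor, i.e. the total spin operator on the auxiliary space) satisfies Λ_α^{(s)}(u) = Σ_{k=1}^{s} t^{(s−k)}(u + kη/2) · Λ_α^{(1)}(u + (2k−s−1)η/2) · t^{(k−1)}(u + (k−s−1)η/2), as operators on H, where t^{(0)}(v) = Id and Λ_α^{(1)}(v) equals the operator entry (1/2)(A−D)(v), C(v), B(v) of the monodromy matrix T^{(1)}(v) for α = z, +, − respectively. -/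

import Mathlib

open Matrix Complex

noncomputable section

/-- The spin-l/2 operator `S^z` on ℂ^{l+1}: `S^z e_k = (l/2 − k) e_k`. -/
def Szm (l : ℕ) : Matrix (Fin (l + 1)) (Fin (l + 1)) ℂ :=
  Matrix.of fun i j => if i = j then ((l : ℂ) / 2 - (i : ℕ)) else 0

/-- The spin-l/2 operator `S^−` on ℂ^{l+1}: `S^− e_k = e_{k+1}` (`S^− e_l = 0`). -/
def Smm (l : ℕ) : Matrix (Fin (l + 1)) (Fin (l + 1)) ℂ :=
  Matrix.of fun i j => if (i : ℕ) = (j : ℕ) + 1 then 1 else 0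

/-- The spin-l/2 operator `S^+` on ℂ^{l+1}: `S^+ e_k = k(l+1−k) e_{k−1}` (`S^+ e_0 = 0`). -/
def Spm (l : ℕ) : Matrix (Fin (l + 1)) (Fin (l + 1)) ℂ :=
  Matrix.of fun i j =>
    if (i : ℕ) + 1 = (j : ℕ) then ((j : ℕ) : ℂ) * ((l : ℂ) + 1 - (j : ℕ)) else 0

/-- The (unnormalized) spin-l/2 Lax operator on ℂ² ⊗ ℂ^{l+1}, in 2×2 block form
`L(λ) = [[λ + η(l/2 + S^z), η S^−],[η S^+, λ + η(l/2 − S^z)]]`. -/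
def Lax (η : ℂ) (l : ℕ) (lam : ℂ) :
    Matrix (Fin 2 × Fin (l + 1)) (Fin 2 × Fin (l + 1)) ℂ :=
  Matrix.of fun p q =>
    if p.1 = 0 ∧ q.1 = 0 then
      (if p.2 = q.2 then lam + η * ((l : ℂ) / 2) else 0) + η * Szm l p.2 q.2
    else if p.1 = 0 ∧ q.1 = 1 then η * Smm l p.2 q.2
    else if p.1 = 1 ∧ q.1 = 0 then η * Spm l p.2 q.2
    else (if p.2 = q.2 then lam + η * ((l : ℂ) / 2) else 0) - η * Szm l p.2 q.2

variable {N : ℕ}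

/-- Embedding of an operator on ℂ²(aux) ⊗ ℂ^{l+1}(site n) into (aux) ⊗ H,
H = ⊗_{n=1}^N ℂ^{l+1}. -/
def embL (l : ℕ) (n : Fin N)
    (M : Matrix (Fin 2 × Fin (l + 1)) (Fin 2 × Fin (l + 1)) ℂ) :
    Matrix (Fin 2 × (Fin N → Fin (l + 1))) (Fin 2 × (Fin N → Fin (l + 1))) ℂ :=
  Matrix.of fun p q =>
    M (p.1, p.2 n) (q.1, q.2 n) *
      ∏ j : Fin N, if j = n then 1 else (if p.2 j = q.2 j then 1 else 0)

/-- The monodromy matrix with two-dimensional auxiliary space: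
`T⁽¹⁾₀(λ) = L₀N(λ) ⋯ L₀₁(λ)` on ℂ²₀ ⊗ H. -/
def T1 (η : ℂ) (l : ℕ) (N : ℕ) (lam : ℂ) :
    Matrix (Fin 2 × (Fin N → Fin (l + 1))) (Fin 2 × (Fin N → Fin (l + 1))) ℂ :=
  ((List.ofFn fun n : Fin N => embL l n (Lax η l lam)).reverse).prod

/-- The operator entry of `T⁽¹⁾(λ)`, so that
`A = blk1 0 0`, `B = blk1 0 1`, `C = blk1 1 0`, `D = blk1 1 1`. -/
def blk1 (η : ℂ) (l : ℕ) (N : ℕ) (ε ε' : Fin 2) (lam : ℂ) :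
    Matrix (Fin N → Fin (l + 1)) (Fin N → Fin (l + 1)) ℂ :=
  Matrix.of fun x y => T1 η l N lam (ε, x) (ε', y)

/-- The matrix of the permutation action of `σ` on (ℂ²)^{⊗s}. -/
def permMat (s : ℕ) (σ : Equiv.Perm (Fin s)) :
    Matrix (Fin s → Fin 2) (Fin s → Fin 2) ℂ :=
  Matrix.of fun a b => if ∀ k, a k = b (σ k) then 1 else 0

/-- The symmetrizer `P⁺ = (1/s!) Σ_{σ ∈ S_s} σ` on (ℂ²)^{⊗s}. -/
def symP (s : ℕ) : Matrix (Fin s → Fin 2) (Fin s → Fin 2) ℂ :=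
  ((s.factorial : ℂ))⁻¹ • ∑ σ : Equiv.Perm (Fin s), permMat s σ

/-- `P⁺ ⊗ Id` on (ℂ²)^{⊗s} ⊗ H. -/
def embSym (l : ℕ) (s : ℕ) :
    Matrix ((Fin s → Fin 2) × (Fin N → Fin (l + 1)))
      ((Fin s → Fin 2) × (Fin N → Fin (l + 1))) ℂ :=
  Matrix.of fun p q => symP s p.1 q.1 * (if p.2 = q.2 then 1 else 0)

/-- Embedding of an operator on ℂ²(auxiliary leg j) ⊗ H into (ℂ²)^{⊗s} ⊗ H. -/
def embA (l : ℕ) (s : ℕ) (j : Fin s)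
    (M : Matrix (Fin 2 × (Fin N → Fin (l + 1))) (Fin 2 × (Fin N → Fin (l + 1))) ℂ) :
    Matrix ((Fin s → Fin 2) × (Fin N → Fin (l + 1)))
      ((Fin s → Fin 2) × (Fin N → Fin (l + 1))) ℂ :=
  Matrix.of fun p q =>
    M (p.1 j, p.2) (q.1 j, q.2) *
      ∏ k : Fin s, if k = j then 1 else (if p.1 k = q.1 k then 1 else 0)

/-- The fused monodromy matrix
`T⁽ˢ⁾(λ) = P⁺ · T⁽¹⁾_{a₁}(λ+(s−1)η/2) ⋯ T⁽¹⁾_{a_s}(λ−(s−1)η/2) · P⁺`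
on (ℂ²)^{⊗s} ⊗ H. -/
def Tfus (η : ℂ) (l : ℕ) (N : ℕ) (s : ℕ) (lam : ℂ) :
    Matrix ((Fin s → Fin 2) × (Fin N → Fin (l + 1)))
      ((Fin s → Fin 2) × (Fin N → Fin (l + 1))) ℂ :=
  embSym l s *
    (List.ofFn fun j : Fin s =>
      embA l s j (T1 η l N (lam + ((s : ℂ) - 1 - 2 * (j : ℕ)) * η / 2))).prod *
    embSym l s

/-- The fused transfer matrix `t⁽ˢ⁾(λ) = tr_{a₁…a_s} T⁽ˢ⁾(λ)` (in particular
`t⁽⁰⁾(λ) = Id`). -/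
def tfus (η : ℂ) (l : ℕ) (N : ℕ) (s : ℕ) (lam : ℂ) :
    Matrix (Fin N → Fin (l + 1)) (Fin N → Fin (l + 1)) ℂ :=
  Matrix.of fun x y => ∑ a : Fin s → Fin 2, Tfus η l N s lam (a, x) (a, y)

/-- The normalized spin components on ℂ²: `σ^z/c_z = (1/2)diag(1,−1)`, `σ^+/c_+ = E^{12}`,
`σ^−/c_− = E^{21}`, indexed by `α ∈ {z, +, −} ≃ {0, 1, 2}`. -/
def sigmaSpin : Fin 3 → Matrix (Fin 2) (Fin 2) ℂ :=
  ![!![1 / 2, 0; 0, -(1 / 2)], !![0, 1; 0, 0], !![0, 0; 1, 0]]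

/-- A 2×2 matrix acting on the `j`-th auxiliary leg of (ℂ²)^{⊗s} ⊗ H, identity elsewhere. -/
def e1H (l : ℕ) (M : Matrix (Fin 2) (Fin 2) ℂ) :
    Matrix (Fin 2 × (Fin N → Fin (l + 1))) (Fin 2 × (Fin N → Fin (l + 1))) ℂ :=
  Matrix.of fun p q => M p.1 q.1 * (if p.2 = q.2 then 1 else 0)

/-- Partial trace over the fused auxiliary space (ℂ²)^{⊗s}. -/
def ptrA (l : ℕ) (s : ℕ)
    (M : Matrix ((Fin s → Fin 2) × (Fin N → Fin (l + 1)))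
      ((Fin s → Fin 2) × (Fin N → Fin (l + 1))) ℂ) :
    Matrix (Fin N → Fin (l + 1)) (Fin N → Fin (l + 1)) ℂ :=
  Matrix.of fun x y => ∑ a : Fin s → Fin 2, M (a, x) (a, y)

/-- `Λ_α^{(s)}(u) = tr_{a₁…a_s}((Σ_{j=1}^s σ^α_{a_j}) · T⁽ˢ⁾(u))`. -/
def LamFus (η : ℂ) (l : ℕ) (N : ℕ) (s : ℕ) (α : Fin 3) (u : ℂ) :
    Matrix (Fin N → Fin (l + 1)) (Fin N → Fin (l + 1)) ℂ :=
  ptrA l s ((∑ j : Fin s, embA l s j (e1H l (sigmaSpin α))) * Tfus η l N s u)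

/-- `Λ_α^{(1)}(v)`: the operator entry `(1/2)(A−D)(v)`, `C(v)`, `B(v)` of the monodromy
matrix `T⁽¹⁾(v)` for `α = z, +, −` respectively. -/
def Lam1 (η : ℂ) (l : ℕ) (N : ℕ) (α : Fin 3) (v : ℂ) :
    Matrix (Fin N → Fin (l + 1)) (Fin N → Fin (l + 1)) ℂ :=
  if α = 0 then (1 / 2 : ℂ) • (blk1 η l N 0 0 v - blk1 η l N 1 1 v)
  else if α = 1 then blk1 η l N 1 0 v
  else blk1 η l N 0 1 v

section SymmetricPower

variable {R : Type*} [Ring R]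

/-- The quadratic relations `P⁺ X₁ Y₂ P⁻ = 0` for two 2×2 matrices with entries in a
noncommutative ring. -/
structure RowSymm (X Y : Matrix (Fin 2) (Fin 2) R) : Prop where
  diag : ∀ i, X i 0 * Y i 1 = X i 1 * Y i 0
  cross : X 0 0 * Y 1 1 + X 1 0 * Y 0 1 = X 0 1 * Y 1 0 + X 1 1 * Y 0 0

/-- The `k`-th column of `X` contracted with the commuting variables `(y, 1)`. -/
def colPoly (X : Matrix (Fin 2) (Fin 2) R) (k : Fin 2) : Polynomial R :=
  Polynomial.C (X 1 k) + Polynomial.C (X 0 k) * Polynomial.X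

theorem colPoly_mul (X Y : Matrix (Fin 2) (Fin 2) R) (k l : Fin 2) :
    colPoly X k * colPoly Y l = Polynomial.C (X 1 k * Y 1 l) +
      Polynomial.C (X 1 k * Y 0 l + X 0 k * Y 1 l) * Polynomial.X +
      Polynomial.C (X 0 k * Y 0 l) * Polynomial.X ^ 2 := by
  have h (r : R) : Polynomial.X * Polynomial.C r = Polynomial.C r * Polynomial.X :=
    Polynomial.X_mul_C r
  have h' (r : R) (q : Polynomial R) :
      Polynomial.X * (Polynomial.C r * q) = Polynomial.C r * (Polynomial.X * q) := by
    rw [← mul_assoc, h, mul_assoc]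
  simp only [colPoly, mul_add, add_mul, mul_assoc, h, h', Polynomial.C_mul, Polynomial.C_add, sq]
  abel

theorem RowSymm.colPoly_swap {X Y : Matrix (Fin 2) (Fin 2) R} (h : RowSymm X Y) :
    colPoly X 0 * colPoly Y 1 = colPoly X 1 * colPoly Y 0 := by
  rw [colPoly_mul, colPoly_mul, h.diag, h.diag, add_comm (X 1 0 * _), h.cross,
    add_comm (X 0 1 * _)]

theorem coeff_zero_colPoly_mul (X : Matrix (Fin 2) (Fin 2) R) (k : Fin 2) (q : Polynomial R) :
    (colPoly X k * q).coeff 0 = X 1 k * q.coeff 0 := by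
  simp [colPoly, add_mul, mul_assoc]

theorem coeff_succ_colPoly_mul (X : Matrix (Fin 2) (Fin 2) R) (k : Fin 2) (q : Polynomial R)
    (n : ℕ) :
    (colPoly X k * q).coeff (n + 1) = X 1 k * q.coeff (n + 1) + X 0 k * q.coeff n := by
  simp [colPoly, add_mul, mul_assoc, Polynomial.coeff_X_mul]

/-- The column of the `s`-th symmetric power of `X 0, …, X (s - 1)` labelled by a word with `p`
zeros, as a generating polynomial over the number of zeros of the row word. -/
def symCol : ℕ → (ℕ → Matrix (Fin 2) (Fin 2) R) → ℕ → Polynomial R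
  | 0, _, _ => 1
  | s + 1, X, 0 => colPoly (X 0) 1 * symCol s (fun n => X (n + 1)) 0
  | s + 1, X, p + 1 => colPoly (X 0) 0 * symCol s (fun n => X (n + 1)) p

theorem symCol_succ_eq (s : ℕ) : ∀ (X : ℕ → Matrix (Fin 2) (Fin 2) R) (p : ℕ),
    (∀ n, RowSymm (X n) (X (n + 1))) → p ≤ s →
    symCol (s + 1) X p = colPoly (X 0) 1 * symCol s (fun n => X (n + 1)) p := by
  induction s with
  | zero => intro X p _ hp; obtain rfl : p = 0 := by omega
            rfl
  | succ s ih =>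
    intro X p hX hp
    cases p with
    | zero => rfl
    | succ p =>
      rw [symCol, ih _ p (fun n => hX (n + 1)) (by omega), ← mul_assoc, (hX 0).colPoly_swap,
        mul_assoc, symCol]

theorem coeff_symCol_eq_zero (s : ℕ) : ∀ (X : ℕ → Matrix (Fin 2) (Fin 2) R) (p m : ℕ),
    s < m → (symCol s X p).coeff m = 0 := by
  induction s with
  | zero => intro X p m h; simp [symCol, Polynomial.coeff_one]; omega
  | succ s ih =>
    intro X p m h
    obtain ⟨m, rfl⟩ : ∃ k, m = k + 1 := ⟨m - 1, by omega⟩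
    cases p <;> rw [symCol, coeff_succ_colPoly_mul, ih _ _ _ (by omega), ih _ _ _ (by omega)] <;>
      simp

/-- The trace of the `s`-th symmetric power of `X 0, …, X (s - 1)`. -/
def symTr (s : ℕ) (X : ℕ → Matrix (Fin 2) (Fin 2) R) : R :=
  ∑ p ∈ Finset.range (s + 1), (symCol s X p).coeff p

/-- The quantum determinant of a pair of 2×2 matrices. -/
def qDet (X Y : Matrix (Fin 2) (Fin 2) R) : R := X 1 1 * Y 0 0 - X 1 0 * Y 0 1

theorem symTr_zero (X : ℕ → Matrix (Fin 2) (Fin 2) R) : symTr 0 X = 1 := by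
  simp [symTr, symCol]

theorem symTr_one (X : ℕ → Matrix (Fin 2) (Fin 2) R) : symTr 1 X = (X 0).trace := by
  simp [symTr, symCol, Finset.sum_range_succ, colPoly, Matrix.trace, add_comm]

/-- The fusion hierarchy. -/
theorem symTr_add_two (X : ℕ → Matrix (Fin 2) (Fin 2) R)
    (hX : ∀ n, RowSymm (X n) (X (n + 1))) (n : ℕ) :
    symTr (n + 2) X = (X 0).trace * symTr (n + 1) (fun m => X (m + 1)) -
      qDet (X 0) (X 1) * symTr n (fun m => X (m + 2)) := by
  set X' := fun m => X (m + 1) with hX'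
  set X'' := fun m => X (m + 2) with hX''
  have key : ∀ r ∈ Finset.range (n + 1),
      X 0 1 1 * (symCol (n + 1) X' (r + 1)).coeff (r + 1) -
        X 0 1 0 * (symCol (n + 1) X' r).coeff (r + 1) =
      qDet (X 0) (X 1) * (symCol n X'' r).coeff r := by
    intro r hr
    have hr' : r ≤ n := by simpa [Nat.lt_succ_iff] using hr
    rw [symCol_succ_eq n X' r (fun m => hX (m + 1)) hr', symCol, coeff_succ_colPoly_mul,
      coeff_succ_colPoly_mul]
    have hd := (hX 0).diag 1
    simp only [hX', zero_add, qDet, mul_add, sub_mul, ← mul_assoc] at hd ⊢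
    rw [hd]
    abel
  have h1 : symTr (n + 2) X = X 0 1 1 * (symCol (n + 1) X' 0).coeff 0 +
      (X 0 0 0 * symTr (n + 1) X' +
        X 0 1 0 * ∑ r ∈ Finset.range (n + 1), (symCol (n + 1) X' r).coeff (r + 1)) := by
    rw [symTr, Finset.sum_range_succ', symCol, coeff_zero_colPoly_mul, add_comm]
    congr 1
    simp only [symCol, coeff_succ_colPoly_mul]
    rw [Finset.sum_add_distrib, ← Finset.mul_sum, ← Finset.mul_sum,
      Finset.sum_range_succ _ (n + 1), coeff_symCol_eq_zero _ _ _ _ (Nat.lt_succ_self (n + 1)),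
      add_zero, add_comm]
    rfl
  have h2 : symTr (n + 1) X' = (symCol (n + 1) X' 0).coeff 0 +
      ∑ r ∈ Finset.range (n + 1), (symCol (n + 1) X' (r + 1)).coeff (r + 1) := by
    rw [symTr, Finset.sum_range_succ', add_comm]
  have h3 := Finset.sum_congr rfl key
  rw [Finset.sum_sub_distrib, ← Finset.mul_sum, ← Finset.mul_sum, ← Finset.mul_sum] at h3
  rw [h1, Matrix.trace_fin_two, add_mul, symTr.eq_1 n, ← h3]
  nth_rw 3 [h2]
  rw [mul_add]
  abel

section Twist

variable {S : Type*} [CommRing S] [Algebra S R]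

/-- The first order twist `(1 + ε σ) X`, with entries in the dual numbers over `R`. -/
def twist (σ : Matrix (Fin 2) (Fin 2) S) (X : Matrix (Fin 2) (Fin 2) R) :
    Matrix (Fin 2) (Fin 2) (DualNumber R) :=
  Matrix.of fun i k =>
    TrivSqZeroExt.inl (X i k) + TrivSqZeroExt.inr (∑ m, σ i m • X m k)

@[simp] theorem fst_twist (σ : Matrix (Fin 2) (Fin 2) S) (X : Matrix (Fin 2) (Fin 2) R)
    (i k : Fin 2) : (twist σ X i k).fst = X i k := by
  simp [twist]

@[simp] theorem snd_twist (σ : Matrix (Fin 2) (Fin 2) S) (X : Matrix (Fin 2) (Fin 2) R)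
    (i k : Fin 2) : (twist σ X i k).snd = ∑ m, σ i m • X m k := by
  simp [twist]

theorem RowSymm.twist {X Y : Matrix (Fin 2) (Fin 2) R} (h : RowSymm X Y)
    (σ : Matrix (Fin 2) (Fin 2) S) : RowSymm (twist σ X) (twist σ Y) := by
  have h0 := h.diag 0
  have h1 := h.diag 1
  have h2 := h.cross
  have h2' : X 0 0 * Y 1 1 = X 0 1 * Y 1 0 + X 1 1 * Y 0 0 - X 1 0 * Y 0 1 := by
    rw [← h2]; abel
  constructor
  · intro i
    fin_cases i <;>
    · ext
      · simp [h0, h1]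
      · simp only [Fin.isValue, Fin.zero_eta, Fin.mk_one, DualNumber.snd_mul, fst_twist,
          snd_twist, Fin.sum_univ_two, mul_add, add_mul, smul_mul_assoc, mul_smul_comm, h0, h1,
          h2']
        module
  · ext
    · simp [h2]
    · simp only [Fin.isValue, DualNumber.snd_mul, fst_twist, TrivSqZeroExt.snd_add,
          snd_twist, Fin.sum_univ_two, mul_add, add_mul, smul_mul_assoc, mul_smul_comm, h0, h1,
          h2']
      module

theorem fst_qDet_twist (X Y : Matrix (Fin 2) (Fin 2) R) (σ : Matrix (Fin 2) (Fin 2) S) :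
    (qDet (twist σ X) (twist σ Y)).fst = qDet X Y := by
  simp [qDet]

theorem snd_qDet_twist {X Y : Matrix (Fin 2) (Fin 2) R} (h : RowSymm X Y)
    (σ : Matrix (Fin 2) (Fin 2) S) (hσ : σ.trace = 0) :
    (qDet (twist σ X) (twist σ Y)).snd = 0 := by
  have hs : σ 1 1 = - σ 0 0 := by
    rw [Matrix.trace_fin_two] at hσ
    exact eq_neg_of_add_eq_zero_right hσ
  simp only [qDet, DualNumber.snd_mul, fst_twist, TrivSqZeroExt.snd_sub, hs,
          snd_twist, Fin.sum_univ_two, mul_add, add_mul, smul_mul_assoc, mul_smul_comm,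
          h.diag]
  module

theorem fst_symTr_twist (σ : Matrix (Fin 2) (Fin 2) S) (s : ℕ)
    (X : ℕ → Matrix (Fin 2) (Fin 2) R) :
    (symTr s (fun n => twist σ (X n))).fst = symTr s X := by
  have hcol : ∀ (s : ℕ) (X : ℕ → Matrix (Fin 2) (Fin 2) R) (p m : ℕ),
      ((symCol s (fun n => twist σ (X n)) p).coeff m).fst = (symCol s X p).coeff m := by
    intro s
    induction s with
    | zero =>
      intro X p m
      simp only [symCol, Polynomial.coeff_one]
      split_ifs <;> simp
    | succ s ih =>
      intro X p m
      cases p <;> cases m <;>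
        simp only [symCol, coeff_zero_colPoly_mul, coeff_succ_colPoly_mul, TrivSqZeroExt.fst_mul,
          TrivSqZeroExt.fst_add, fst_twist, ih (fun n => X (n + 1))]
  simp [symTr, TrivSqZeroExt.fst_sum, hcol]

/-- Leibniz rule for the first order variation of the traces of symmetric powers under a
traceless twist. -/
theorem snd_symTr_twist (σ : Matrix (Fin 2) (Fin 2) S) (hσ : σ.trace = 0) (s : ℕ) :
    ∀ (X : ℕ → Matrix (Fin 2) (Fin 2) R), (∀ n, RowSymm (X n) (X (n + 1))) →
    (symTr s (fun n => twist σ (X n))).snd =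
      ∑ i ∈ Finset.range s, symTr i X * (twist σ (X i)).trace.snd *
        symTr (s - 1 - i) (fun n => X (n + (i + 1))) := by
  induction s using Nat.strong_induction_on with
  | _ s ih =>
  intro X hX
  match s with
  | 0 => simp [symTr_zero]
  | 1 => simp [symTr_zero, symTr_one]
  | n + 2 =>
    have hT := symTr_add_two (fun n => twist σ (X n)) (fun n => (hX n).twist σ) n
    have hT' := congrArg TrivSqZeroExt.snd hT
    have e1 := ih (n + 1) (by omega) (fun m => X (m + 1)) (fun m => hX (m + 1))
    have e2 := ih n (by omega) (fun m => X (m + 2)) (fun m => hX (m + 2))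
    have f1 := fst_symTr_twist σ (n + 1) (fun m => X (m + 1))
    have hfst : (twist σ (X 0)).trace.fst = (X 0).trace := by
      simp [Matrix.trace]
    rw [TrivSqZeroExt.snd_sub, DualNumber.snd_mul, DualNumber.snd_mul, snd_qDet_twist (hX 0) σ hσ,
      fst_qDet_twist, e1, e2, f1, hfst, zero_mul, add_zero] at hT'
    have hterm : ∀ i ∈ Finset.range n,
        symTr (i + 2) X * (twist σ (X (i + 2))).trace.snd *
            symTr (n + 2 - 1 - (i + 2)) (fun m => X (m + (i + 2 + 1))) =
          (X 0).trace * (symTr (i + 1) (fun m => X (m + 1)) *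
            (twist σ (X (i + 1 + 1))).trace.snd *
              symTr (n + 1 - 1 - (i + 1)) (fun m => X (m + (i + 1 + 1) + 1))) -
          qDet (X 0) (X 1) * (symTr i (fun m => X (m + 2)) * (twist σ (X (i + 2))).trace.snd *
            symTr (n - 1 - i) (fun m => X (m + (i + 1) + 2))) := by
      intro i _
      rw [symTr_add_two X hX, show n + 2 - 1 - (i + 2) = n - 1 - i by omega,
        show n + 1 - 1 - (i + 1) = n - 1 - i by omega]
      simp only [sub_mul, mul_assoc]
      rfl
    rw [hT', Finset.sum_range_succ', Finset.sum_range_succ' _ (n + 1), Finset.sum_range_succ' _ n,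
      Finset.sum_congr rfl hterm, Finset.sum_sub_distrib, ← Finset.mul_sum, ← Finset.mul_sum,
      symTr_zero, symTr_zero, zero_add, symTr_one, one_mul, one_mul, mul_add]
    simp only [add_assoc, Nat.sub_zero, Nat.reduceAdd, mul_assoc, Nat.add_one_sub_one]
    abel

end Twist

section Words

open scoped Nat

/-- The number of zeros of a binary word. -/
def zeroCount {s : ℕ} (a : Fin s → Fin 2) : ℕ := ∑ j, if a j = 0 then 1 else 0

theorem zeroCount_le {s : ℕ} (a : Fin s → Fin 2) : zeroCount a ≤ s :=
  (Finset.sum_le_card_nsmul _ _ 1 (fun j _ => by split_ifs <;> simp)).trans (by simp)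

theorem zeroCount_cons {s : ℕ} (i : Fin 2) (a : Fin s → Fin 2) :
    zeroCount (Fin.cons i a : Fin (s + 1) → Fin 2) = (if i = 0 then 1 else 0) + zeroCount a := by
  rw [zeroCount, Fin.sum_univ_succ]
  simp only [Fin.cons_zero, Fin.cons_succ, zeroCount]

theorem zeroCount_comp_perm {s : ℕ} (a : Fin s → Fin 2) (σ : Equiv.Perm (Fin s)) :
    zeroCount (a ∘ σ) = zeroCount a :=
  Equiv.sum_comp σ fun j => if a j = 0 then 1 else 0

theorem zeroCount_eq_card {s : ℕ} (a : Fin s → Fin 2) :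
    zeroCount a = Fintype.card {j // a j = 0} := by
  simp [zeroCount, Fintype.card_subtype]

theorem sub_zeroCount_eq_card {s : ℕ} (a : Fin s → Fin 2) :
    s - zeroCount a = Fintype.card {j // a j = 1} := by
  have h := Fintype.card_subtype_compl fun j => a j = 0
  have hi : ∀ i : Fin 2, ¬ i = 0 ↔ i = 1 := by decide
  simp only [hi, Fintype.card_fin] at h
  rw [h, zeroCount_eq_card]

theorem exists_comp_perm_eq {s : ℕ} {a b : Fin s → Fin 2} (h : zeroCount a = zeroCount b) :
    ∃ σ : Equiv.Perm (Fin s), b ∘ σ = a := by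
  have h0 : ∀ i : Fin 2, Nonempty ({j // a j = i} ≃ {j // b j = i}) := by
    intro i
    rw [← Fintype.card_eq]
    fin_cases i
    · simpa [zeroCount_eq_card] using h
    · simpa [sub_zeroCount_eq_card] using congrArg (s - ·) h
  let e : (i : Fin 2) → {j // a j = i} ≃ {j // b j = i} := fun i => (h0 i).some
  refine ⟨(Equiv.sigmaFiberEquiv a).symm.trans
    ((Equiv.sigmaCongrRight e).trans (Equiv.sigmaFiberEquiv b)), ?_⟩
  funext j
  exact (e (a j) ⟨j, rfl⟩).2

theorem card_comp_perm_eq {s : ℕ} (a b : Fin s → Fin 2) :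
    Fintype.card {σ : Equiv.Perm (Fin s) // b ∘ σ = a} =
      if zeroCount a = zeroCount b then (zeroCount b)! * (s - zeroCount b)! else 0 := by
  split_ifs with h
  · obtain ⟨τ, rfl⟩ := exists_comp_perm_eq h
    have hs := DomMulAct.stabilizer_card b
    rw [Fin.prod_univ_two, ← zeroCount_eq_card, ← sub_zeroCount_eq_card] at hs
    rw [← hs]
    refine Fintype.card_congr ((Equiv.mulRight τ⁻¹).subtypeEquiv fun σ => ?_)
    constructor
    · intro hσ
      funext j
      simpa using congrFun hσ (τ⁻¹ j)
    · intro hσ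
      funext j
      simpa using congrFun hσ (τ j)
  · rw [Fintype.card_eq_zero_iff]
    exact ⟨fun σ => h (by rw [← σ.2, zeroCount_comp_perm])⟩

theorem sum_comp_perm {M : Type*} [AddCommMonoid M] {s : ℕ} (b : Fin s → Fin 2)
    (h : (Fin s → Fin 2) → M) :
    ∑ σ : Equiv.Perm (Fin s), h (b ∘ σ) =
      ((zeroCount b)! * (s - zeroCount b)!) • ∑ a with zeroCount a = zeroCount b, h a := by
  classical
  rw [← Finset.sum_fiberwise Finset.univ (fun σ : Equiv.Perm (Fin s) => b ∘ σ),
    Finset.sum_filter, Finset.smul_sum]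
  refine Finset.sum_congr rfl fun a _ => ?_
  rw [Finset.sum_congr rfl (g := fun _ => h a) (by simp +contextual), Finset.sum_const,
    ← Fintype.card_subtype, card_comp_perm_eq]
  split_ifs <;> simp

theorem exists_zeroCount_eq {s p : ℕ} (hp : p ≤ s) : ∃ b : Fin s → Fin 2, zeroCount b = p := by
  induction s generalizing p with
  | zero => exact ⟨Fin.elim0, by simp [zeroCount]; omega⟩
  | succ s ih =>
    cases p with
    | zero => exact ⟨fun _ => 1, by simp [zeroCount]⟩
    | succ p =>
      obtain ⟨b, hb⟩ := ih (p := p) (by omega)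
      exact ⟨Fin.cons 0 b, by rw [zeroCount_cons, hb]; simp [add_comm]⟩

theorem card_zeroCount_eq {s p : ℕ} (hp : p ≤ s) :
    p ! * (s - p)! * (Finset.univ.filter fun a : Fin s → Fin 2 => zeroCount a = p).card = s ! := by
  obtain ⟨b, rfl⟩ := exists_zeroCount_eq hp
  simpa [Fintype.card_perm] using (sum_comp_perm b fun _ => (1 : ℕ)).symm

/-- Averaging over permutations reduces a sum over words to a sum over classes of words. -/
theorem sum_perm_sum_words {M : Type*} [AddCommMonoid M] {s : ℕ}
    (F : (Fin s → Fin 2) → (Fin s → Fin 2) → M) (g : ℕ → ℕ → M)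
    (h : ∀ p b, ∑ a with zeroCount a = p, F a b = g p (zeroCount b)) :
    ∑ σ : Equiv.Perm (Fin s), ∑ a, F (a ∘ σ) a = s ! • ∑ p ∈ Finset.range (s + 1), g p p := by
  rw [Finset.sum_comm]
  simp only [fun a => sum_comp_perm a fun c => F c a, h]
  rw [← Finset.sum_fiberwise_of_maps_to (t := Finset.range (s + 1)) (g := zeroCount)
    (fun a _ => Finset.mem_range.2 (Nat.lt_succ_of_le (zeroCount_le a))), Finset.smul_sum]
  refine Finset.sum_congr rfl fun p hp => ?_
  rw [Finset.sum_congr rfl (g := fun _ => (p ! * (s - p)!) • g p p) (by simp +contextual),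
    Finset.sum_const, smul_smul, mul_comm,
    card_zeroCount_eq (Nat.lt_succ_iff.1 (Finset.mem_range.1 hp))]

end Words

/-- The matrix element of `X 0 ⊗ ⋯ ⊗ X (s - 1)` between two words. -/
def wordProd (X : ℕ → Matrix (Fin 2) (Fin 2) R) {s : ℕ} (a b : Fin s → Fin 2) : R :=
  (List.ofFn fun j : Fin s => X j (a j) (b j)).prod

theorem wordProd_cons (X : ℕ → Matrix (Fin 2) (Fin 2) R) {s : ℕ} (i k : Fin 2)
    (a b : Fin s → Fin 2) :
    wordProd X (Fin.cons i a : Fin (s + 1) → Fin 2) (Fin.cons k b : Fin (s + 1) → Fin 2) =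
      X 0 i k * wordProd (fun n => X (n + 1)) a b := by
  simp [wordProd, List.ofFn_succ]

theorem sum_words_succ {M : Type*} [AddCommMonoid M] {s : ℕ} (f : (Fin (s + 1) → Fin 2) → M) :
    ∑ a, f a = ∑ i, ∑ a : Fin s → Fin 2, f (Fin.cons i a) := by
  rw [← (Fin.consEquiv fun _ => Fin 2).sum_comp, Fintype.sum_prod_type]
  rfl

theorem sum_wordProd (s : ℕ) : ∀ (X : ℕ → Matrix (Fin 2) (Fin 2) R)
    (_ : ∀ n, RowSymm (X n) (X (n + 1))) (b : Fin s → Fin 2),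
    ∑ a : Fin s → Fin 2, Polynomial.C (wordProd X a b) * Polynomial.X ^ zeroCount a =
      symCol s X (zeroCount b) := by
  induction s with
  | zero =>
    intro X _ b
    simp [wordProd, zeroCount, symCol]
  | succ s ih =>
    intro X hX b
    obtain ⟨k, b, rfl⟩ : ∃ k b', b = (Fin.cons k b' : Fin (s + 1) → Fin 2) :=
      ⟨b 0, Fin.tail b, (Fin.cons_self_tail b).symm⟩
    have hstep : ∀ k : Fin 2, symCol (s + 1) X ((if k = 0 then 1 else 0) + zeroCount b) =
        colPoly (X 0) k * symCol s (fun n => X (n + 1)) (zeroCount b) := by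
      intro k
      fin_cases k
      · simp [symCol, Nat.add_comm 1]
      · simpa using symCol_succ_eq s X (zeroCount b) hX (zeroCount_le b)
    rw [zeroCount_cons, hstep, ← ih _ (fun n => hX (n + 1)), sum_words_succ, Fin.sum_univ_two,
      colPoly, add_mul, Finset.mul_sum, Finset.mul_sum, add_comm]
    congr 1 <;> refine Finset.sum_congr rfl fun a _ => ?_
    · simp [wordProd_cons, zeroCount_cons, mul_assoc]
    · rw [wordProd_cons, zeroCount_cons, if_pos rfl, pow_add, pow_one, Polynomial.C_mul,
        mul_assoc, mul_assoc, ← mul_assoc Polynomial.X (Polynomial.C _), Polynomial.X_mul_C,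
        mul_assoc]

/-- The symmetrized trace of `X 0 ⊗ ⋯ ⊗ X (s - 1)` is the trace of the symmetric power. -/
theorem sum_perm_wordProd (s : ℕ) (X : ℕ → Matrix (Fin 2) (Fin 2) R)
    (hX : ∀ n, RowSymm (X n) (X (n + 1))) :
    ∑ σ : Equiv.Perm (Fin s), ∑ a : Fin s → Fin 2, wordProd X (a ∘ σ) a =
      s.factorial • symTr s X := by
  refine sum_perm_sum_words (wordProd X) (fun p p' => (symCol s X p').coeff p) fun p b => ?_
  rw [← sum_wordProd s X hX b, Polynomial.finsetSum_coeff, Finset.sum_filter]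
  simp [Polynomial.coeff_X_pow, eq_comm]

section Insert

variable {S : Type*} [CommRing S] [Algebra S R]

theorem fst_wordProd_twist (σ : Matrix (Fin 2) (Fin 2) S) (X : ℕ → Matrix (Fin 2) (Fin 2) R)
    {s : ℕ} (a b : Fin s → Fin 2) :
    (wordProd (fun n => twist σ (X n)) a b).fst = wordProd X a b := by
  simp [wordProd, TrivSqZeroExt.fst_list_prod, Function.comp_def]

theorem snd_wordProd_twist (σ : Matrix (Fin 2) (Fin 2) S) {s : ℕ} :
    ∀ (X : ℕ → Matrix (Fin 2) (Fin 2) R) (a b : Fin s → Fin 2),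
    (wordProd (fun n => twist σ (X n)) a b).snd =
      ∑ j, ∑ c, σ (a j) c • wordProd X (Function.update a j c) b := by
  induction s with
  | zero => intro X a b; simp [wordProd]
  | succ s ih =>
    intro X a b
    obtain ⟨i, a, rfl⟩ : ∃ k b', a = (Fin.cons k b' : Fin (s + 1) → Fin 2) :=
      ⟨a 0, Fin.tail a, (Fin.cons_self_tail a).symm⟩
    obtain ⟨k, b, rfl⟩ : ∃ k b', b = (Fin.cons k b' : Fin (s + 1) → Fin 2) :=
      ⟨b 0, Fin.tail b, (Fin.cons_self_tail b).symm⟩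
    rw [wordProd_cons, DualNumber.snd_mul, ih (fun n => X (n + 1)),
      fst_wordProd_twist σ (fun n => X (n + 1)), Fin.sum_univ_succ, add_comm]
    simp only [fst_twist, snd_twist, Fin.cons_zero, Fin.cons_succ, Fin.update_cons_zero,
      ← Fin.cons_update, wordProd_cons, Finset.mul_sum, Finset.sum_mul, smul_mul_assoc,
      mul_smul_comm]

end Insert

end SymmetricPower

section LegOp

variable {ι κ R : Type*} [Fintype ι] [DecidableEq ι] [DecidableEq κ] [Ring R]

/-- The matrix `Y` acting on the tensor factor `j` of `(R^κ)^{⊗ι}`. -/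
def legOp (j : ι) (Y : Matrix κ κ R) : Matrix (ι → κ) (ι → κ) R :=
  Matrix.of fun a b => if ∀ k, k ≠ j → a k = b k then Y (a j) (b j) else 0

theorem legOp_apply_eq_mul_prod {S : Type*} [CommRing S] (j : ι) (Y : Matrix κ κ S)
    (a b : ι → κ) :
    legOp j Y a b = Y (a j) (b j) *
      ∏ k, if k = j then 1 else (if a k = b k then 1 else 0) := by
  rw [legOp, Matrix.of_apply]
  split_ifs with h
  · rw [Finset.prod_eq_one, mul_one]
    intro k _
    split_ifs with h1 h2
    · rfl
    · rfl
    · exact absurd (h k h1) h2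
  · push Not at h
    obtain ⟨k, hk, hne⟩ := h
    rw [Finset.prod_eq_zero (Finset.mem_univ k), mul_zero]
    simp [hk, hne]

theorem legOp_add (j : ι) (Y Z : Matrix κ κ R) : legOp j (Y + Z) = legOp j Y + legOp j Z := by
  ext a b
  simp only [legOp, Matrix.of_apply, Matrix.add_apply]
  split_ifs <;> simp

variable [Fintype κ]

theorem legOp_mul_apply (j : ι) (Y : Matrix κ κ R) (M : Matrix (ι → κ) (ι → κ) R)
    (a b : ι → κ) :
    (legOp j Y * M) a b = ∑ c, Y (a j) c * M (Function.update a j c) b := by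
  rw [Matrix.mul_apply]
  symm
  refine Fintype.sum_of_injective (Function.update a j) (Function.update_injective a j) _ _ ?_ ?_
  · intro c hc
    rw [legOp, Matrix.of_apply, if_neg, zero_mul]
    intro h
    refine hc ⟨c j, ?_⟩
    ext k
    by_cases hk : k = j
    · subst hk; simp
    · simp [hk, h k hk]
  · intro c
    rw [legOp, Matrix.of_apply, if_pos]
    · simp
    · intro k hk
      simp [hk]

theorem legOp_mul (j : ι) (Y Z : Matrix κ κ R) : legOp j Y * legOp j Z = legOp j (Y * Z) := by
  ext a b
  rw [legOp_mul_apply]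
  have h : ∀ c, (∀ k, k ≠ j → Function.update a j c k = b k) ↔ ∀ k, k ≠ j → a k = b k := by
    intro c
    refine forall₂_congr fun k hk => ?_
    simp [hk]
  simp only [legOp, Matrix.of_apply, h, Function.update_self, Matrix.mul_apply]
  split_ifs <;> simp

theorem prod_legOp_apply (X : ι → Matrix κ κ R) (L : List ι) (hL : L.Nodup) (a b : ι → κ) :
    (L.map fun j => legOp j (X j)).prod a b =
      if ∀ k, k ∉ L → a k = b k then (L.map fun j => X j (a j) (b j)).prod else 0 := by
  induction L generalizing a with
  | nil => simp [Matrix.one_apply, funext_iff]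
  | cons j L ih =>
    obtain ⟨hj, hL⟩ := List.nodup_cons.1 hL
    rw [List.map_cons, List.prod_cons, legOp_mul_apply, Finset.sum_eq_single (b j)]
    · rw [ih hL, List.map_cons, List.prod_cons]
      have h1 : (∀ k, k ∉ L → Function.update a j (b j) k = b k) ↔
          ∀ k, k ∉ j :: L → a k = b k := by
        refine forall_congr' fun k => ?_
        by_cases hk : k = j
        · subst hk; simp
        · simp [hk]
      have h2 : (L.map fun i => X i (Function.update a j (b j) i) (b i)) =
          L.map fun i => X i (a i) (b i) := by
        refine List.map_congr_left fun i hi => ?_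
        rw [Function.update_of_ne (ne_of_mem_of_not_mem hi hj)]
      rw [h2, if_congr h1 rfl rfl]
      split_ifs <;> simp
    · intro c _ hc
      rw [ih hL, if_neg, mul_zero]
      intro h
      exact hc (by simpa using h j hj)
    · simp

theorem legOp_commute {S : Type*} [CommRing S] {i j : ι} (hij : i ≠ j) (Y Z : Matrix κ κ S) :
    Commute (legOp i Y) (legOp j Z) := by
  let X : ι → Matrix κ κ S := fun k => if k = i then Y else Z
  have hi : X i = Y := if_pos rfl
  have hj : X j = Z := if_neg hij.symm
  ext a b
  have h1 := prod_legOp_apply X [i, j] (by simp [hij]) a b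
  have h2 := prod_legOp_apply X [j, i] (by simp [hij.symm]) a b
  simp only [List.map_cons, List.map_nil, List.prod_cons, List.prod_nil, mul_one, hi, hj] at h1 h2
  rw [h1, h2, mul_comm (Y _ _)]
  simp [or_comm]

end LegOp

section Rows

variable {R : Type*} [Ring R]

theorem RowSymm.one : RowSymm (1 : Matrix (Fin 2) (Fin 2) R) 1 where
  diag i := by fin_cases i <;> simp
  cross := by simp

theorem RowSymm.mul {X Y X' Y' : Matrix (Fin 2) (Fin 2) R} (h : RowSymm X Y)
    (h' : RowSymm X' Y') (hc : ∀ i j k l, Commute (X' i k) (Y j l)) :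
    RowSymm (X * X') (Y * Y') := by
  have hm : ∀ i k m j n l : Fin 2, X i m * X' m k * (Y j n * Y' n l) =
      X i m * Y j n * (X' m k * Y' n l) := by
    intro i k m j n l
    rw [mul_assoc, ← mul_assoc (X' m k), (hc m j k n).eq]
    simp only [mul_assoc]
  have hcr : ∀ r : R, r * (X' 0 0 * Y' 1 1) =
      r * (X' 0 1 * Y' 1 0) + r * (X' 1 1 * Y' 0 0) - r * (X' 1 0 * Y' 0 1) := by
    intro r
    rw [← mul_add, ← mul_sub, ← h'.cross]
    simp
  have hcr' : X 0 0 * Y 1 1 = X 0 1 * Y 1 0 + X 1 1 * Y 0 0 - X 1 0 * Y 0 1 := by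
    rw [← h.cross]; abel
  constructor
  · intro i
    simp only [Matrix.mul_apply, Fin.sum_univ_two, mul_add, add_mul, hm, h.diag, h'.diag, hcr]
    abel
  · simp only [Matrix.mul_apply, Fin.sum_univ_two, mul_add, add_mul, hm, h'.diag, hcr, hcr',
      sub_mul]
    abel

theorem RowSymm.legOp {ι κ S : Type*} [Fintype ι] [DecidableEq ι] [Fintype κ] [DecidableEq κ]
    [CommRing S] {X Y : Matrix (Fin 2) (Fin 2) (Matrix κ κ S)} (h : RowSymm X Y) (n : ι) :
    RowSymm (X.map (legOp n)) (Y.map (legOp n)) where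
  diag i := by simp [legOp_mul, h.diag]
  cross := by simp [legOp_mul, ← legOp_add, h.cross]

end Rows

section Monodromy

theorem Szm_eq_diagonal (l : ℕ) :
    Szm l = Matrix.diagonal fun i : Fin (l + 1) => (l : ℂ) / 2 - (i : ℕ) := rfl

theorem Szm_mul_Smm (l : ℕ) : Szm l * Smm l = Smm l * Szm l - Smm l := by
  ext i j
  rw [Szm_eq_diagonal, Matrix.sub_apply, Matrix.diagonal_mul, Matrix.mul_diagonal]
  simp only [Smm, Matrix.of_apply]
  split_ifs with h
  · rw [h]; push_cast; ring
  · simp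

theorem Szm_mul_Spm (l : ℕ) : Szm l * Spm l = Spm l * Szm l + Spm l := by
  ext i j
  rw [Szm_eq_diagonal, Matrix.add_apply, Matrix.diagonal_mul, Matrix.mul_diagonal]
  simp only [Spm, Matrix.of_apply]
  split_ifs with h
  · rw [← h]; push_cast; ring
  · simp

theorem Spm_mul_Smm_apply (l : ℕ) (i j : Fin (l + 1)) :
    (Spm l * Smm l) i j = if i = j then ((i : ℕ) + 1 : ℂ) * (l - (i : ℕ)) else 0 := by
  rw [Matrix.mul_apply]
  by_cases hi : (i : ℕ) + 1 < l + 1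
  · rw [Finset.sum_eq_single ⟨i + 1, hi⟩]
    · simp only [Spm, Smm, Matrix.of_apply, if_true, Nat.add_right_cancel_iff, Fin.ext_iff]
      split_ifs <;> push_cast <;> ring
    · intro k _ hk
      have : ¬ (i : ℕ) + 1 = k := fun h => hk (Fin.ext h.symm)
      simp [Spm, this]
    · simp
  · have hl : (i : ℕ) = l := by omega
    rw [Finset.sum_eq_zero]
    · simp [hl]
    · intro k _
      have : ¬ (i : ℕ) + 1 = k := by omega
      simp [Spm, this]

theorem Smm_mul_Spm_apply (l : ℕ) (i j : Fin (l + 1)) :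
    (Smm l * Spm l) i j = if i = j then ((i : ℕ) : ℂ) * (l + 1 - (i : ℕ)) else 0 := by
  rw [Matrix.mul_apply]
  by_cases hi : (i : ℕ) = 0
  · rw [Finset.sum_eq_zero]
    · simp [hi]
    · intro k _
      simp [Smm, hi]
  · have hi' : (i : ℕ) - 1 + 1 = i := by omega
    rw [Finset.sum_eq_single ⟨(i : ℕ) - 1, by omega⟩]
    · simp only [Spm, Smm, Matrix.of_apply, hi', if_true, Fin.ext_iff, one_mul]
      split_ifs with h
      · rw [h]
      · rfl
    · intro k _ hk
      have : ¬ (i : ℕ) = k + 1 := fun h => hk (Fin.ext (by simp [h]))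
      simp [Smm, this]
    · simp

theorem Spm_mul_Smm (l : ℕ) : Spm l * Smm l = Smm l * Spm l + (2 : ℂ) • Szm l := by
  ext i j
  rw [Matrix.add_apply, Matrix.smul_apply, Spm_mul_Smm_apply, Smm_mul_Spm_apply,
    Szm_eq_diagonal, Matrix.diagonal_apply]
  split_ifs
  · rw [smul_eq_mul]; ring
  · simp

/-- The Lax operator as a 2×2 matrix of operators. -/
def laxBlock (η : ℂ) (l : ℕ) (v : ℂ) :
    Matrix (Fin 2) (Fin 2) (Matrix (Fin (l + 1)) (Fin (l + 1)) ℂ) :=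
  !![(v + η * (l / 2)) • 1 + η • Szm l, η • Smm l;
    η • Spm l, (v + η * (l / 2)) • 1 - η • Szm l]

theorem Lax_apply (η : ℂ) (l : ℕ) (v : ℂ) (i k : Fin 2) (x y : Fin (l + 1)) :
    Lax η l v (i, x) (k, y) = laxBlock η l v i k x y := by
  fin_cases i <;> fin_cases k <;> simp [Lax, laxBlock, Matrix.one_apply]

theorem rowSymm_laxBlock (η : ℂ) (l : ℕ) (v : ℂ) :
    RowSymm (laxBlock η l v) (laxBlock η l (v - η)) := by
  constructor
  · intro i
    fin_cases i <;>
    · simp [laxBlock, add_mul, mul_add, sub_mul, mul_sub, Szm_mul_Smm, Szm_mul_Spm]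
      module
  · simp [laxBlock, add_mul, mul_add, sub_mul, mul_sub, Spm_mul_Smm]
    module

/-- The monodromy matrix as a 2×2 matrix of operators on the quantum space. -/
def monodromyBlock (η : ℂ) (l N : ℕ) (v : ℂ) :
    Matrix (Fin 2) (Fin 2) (Matrix (Fin N → Fin (l + 1)) (Fin N → Fin (l + 1)) ℂ) :=
  (Matrix.compRingEquiv (Fin 2) (Fin N → Fin (l + 1)) ℂ).symm (T1 η l N v)

theorem monodromyBlock_apply (η : ℂ) (l N : ℕ) (v : ℂ) (i k : Fin 2) :
    monodromyBlock η l N v i k = blk1 η l N i k v := rfl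

theorem monodromyBlock_eq_prod (η : ℂ) (l N : ℕ) (v : ℂ) :
    monodromyBlock η l N v =
      ((List.finRange N).reverse.map fun n => (laxBlock η l v).map (legOp n)).prod := by
  rw [monodromyBlock, T1, List.ofFn_eq_map, ← List.map_reverse, map_list_prod, List.map_map]
  congr 1
  refine List.map_congr_left fun n _ => ?_
  ext i k x y
  change embL l n (Lax η l v) (i, x) (k, y) = legOp n (laxBlock η l v i k) x y
  rw [legOp_apply_eq_mul_prod, ← Lax_apply]
  rfl

theorem rowSymm_prod_laxBlock (η : ℂ) (l : ℕ) (v : ℂ) (L : List (Fin N)) (hL : L.Nodup) :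
    RowSymm (L.map fun n => (laxBlock η l v).map (legOp n)).prod
      (L.map fun n => (laxBlock η l (v - η)).map (legOp n)).prod := by
  have hcomm : ∀ (w : ℂ) (n : Fin N) (L : List (Fin N)) (Z : Matrix _ _ ℂ), n ∉ L → ∀ i k,
      Commute ((L.map fun n => (laxBlock η l w).map (legOp n)).prod i k) (legOp n Z) := by
    intro w n L Z
    induction L with
    | nil =>
      intro _ i k
      rw [List.map_nil, List.prod_nil, Matrix.one_apply]
      split_ifs
      · exact Commute.one_left _
      · exact Commute.zero_left _
    | cons m L ih =>
      intro hn i k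
      rw [List.mem_cons, not_or] at hn
      rw [List.map_cons, List.prod_cons, Matrix.mul_apply]
      exact Commute.sum_left _ _ _ fun c _ =>
        Commute.mul_left (legOp_commute (Ne.symm hn.1) _ _) (ih hn.2 c k)
  induction L with
  | nil => exact RowSymm.one
  | cons n L ih =>
    obtain ⟨hn, hL⟩ := List.nodup_cons.1 hL
    simp only [List.map_cons, List.prod_cons]
    exact ((rowSymm_laxBlock η l v).legOp n).mul (ih hL) fun i j k m => hcomm v n L _ hn i k

theorem rowSymm_monodromyBlock (η : ℂ) (l N : ℕ) (v : ℂ) :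
    RowSymm (monodromyBlock η l N v) (monodromyBlock η l N (v - η)) := by
  rw [monodromyBlock_eq_prod, monodromyBlock_eq_prod]
  exact rowSymm_prod_laxBlock η l v _ (List.nodup_reverse.2 (List.nodup_finRange N))

end Monodromy

section Symmetrizer

theorem permMat_mul_apply {s : ℕ} {R : Type*} [Ring R] [Algebra ℂ R] (π : Equiv.Perm (Fin s))
    (M : Matrix (Fin s → Fin 2) (Fin s → Fin 2) R) (a b : Fin s → Fin 2) :
    ((algebraMap ℂ R).mapMatrix (permMat s π) * M) a b = M (a ∘ ⇑π⁻¹) b := by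
  rw [Matrix.mul_apply, Finset.sum_eq_single (a ∘ ⇑π⁻¹)]
  · simp [permMat]
  · intro c _ hc
    have : ¬ ∀ k, a k = c (π k) := fun h => hc (funext fun k => by simp [h])
    simp [permMat, this]
  · simp

theorem permMat_mul_apply' {s : ℕ} (π : Equiv.Perm (Fin s))
    (M : Matrix (Fin s → Fin 2) (Fin s → Fin 2) ℂ) (a b : Fin s → Fin 2) :
    (permMat s π * M) a b = M (a ∘ ⇑π⁻¹) b := by
  simpa using permMat_mul_apply (R := ℂ) π M a b

theorem mul_permMat_apply {s : ℕ} (π : Equiv.Perm (Fin s))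
    (M : Matrix (Fin s → Fin 2) (Fin s → Fin 2) ℂ) (a b : Fin s → Fin 2) :
    (M * permMat s π) a b = M a (b ∘ π) := by
  rw [Matrix.mul_apply, Finset.sum_eq_single (b ∘ π)]
  · simp [permMat]
  · intro c _ hc
    have : ¬ ∀ k, c k = b (π k) := fun h => hc (funext fun k => by simp [h])
    simp [permMat, this]
  · simp

theorem permMat_mul {s : ℕ} (π τ : Equiv.Perm (Fin s)) :
    permMat s π * permMat s τ = permMat s (τ * π) := by
  ext a b
  rw [mul_permMat_apply]
  simp only [permMat, Matrix.of_apply, Equiv.Perm.coe_mul, Function.comp_apply]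
  congr

theorem permMat_mul_symP {s : ℕ} (π : Equiv.Perm (Fin s)) : permMat s π * symP s = symP s := by
  rw [symP, Matrix.mul_smul, Finset.mul_sum]
  simp only [permMat_mul]
  rw [← Equiv.sum_comp (Equiv.mulRight π) fun τ => permMat s τ]
  rfl

theorem symP_mul_symP (s : ℕ) : symP s * symP s = symP s := by
  have hs : (s.factorial : ℂ) ≠ 0 := Nat.cast_ne_zero.2 (Nat.factorial_ne_zero s)
  nth_rw 1 [symP]
  rw [Matrix.smul_mul, Finset.sum_mul]
  simp [permMat_mul_symP, Fintype.card_perm, ← Nat.cast_smul_eq_nsmul ℂ, smul_smul, hs]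

theorem permMat_mul_legOp {s : ℕ} (π : Equiv.Perm (Fin s)) (j : Fin s)
    (Y : Matrix (Fin 2) (Fin 2) ℂ) :
    permMat s π * legOp (π j) Y = legOp j Y * permMat s π := by
  ext a b
  rw [permMat_mul_apply', mul_permMat_apply, legOp, legOp, Matrix.of_apply, Matrix.of_apply]
  have h : (∀ k, k ≠ π j → (a ∘ ⇑π⁻¹) k = b k) ↔ ∀ k, k ≠ j → a k = (b ∘ π) k := by
    rw [← π.forall_congr_right]
    simp
  split_ifs with h1 h2 h2
  · simp
  · exact absurd (h.1 h1) h2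
  · exact absurd (h.2 h2) h1
  · rfl

theorem commute_symP_sum_legOp (s : ℕ) (Y : Matrix (Fin 2) (Fin 2) ℂ) :
    Commute (symP s) (∑ j : Fin s, legOp j Y) := by
  refine Commute.smul_left (Commute.sum_left _ _ _ fun π _ => ?_) _
  rw [Commute, SemiconjBy, Finset.mul_sum, Finset.sum_mul,
    ← Equiv.sum_comp π fun j => permMat s π * legOp j Y]
  exact Finset.sum_congr rfl fun j _ => permMat_mul_legOp π j Y

variable {R : Type*} [Ring R] [Algebra ℂ R]

theorem trace_mapMatrix_mul_comm {I : Type*} [Fintype I] [DecidableEq I] (P : Matrix I I ℂ)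
    (M : Matrix I I R) :
    ((algebraMap ℂ R).mapMatrix P * M).trace = (M * (algebraMap ℂ R).mapMatrix P).trace := by
  simp only [Matrix.trace, Matrix.diag_apply, Matrix.mul_apply, RingHom.mapMatrix_apply,
    Matrix.map_apply, Algebra.commutes]
  rw [Finset.sum_comm]

theorem trace_symP_mul (s : ℕ) (M : Matrix (Fin s → Fin 2) (Fin s → Fin 2) R) :
    ((algebraMap ℂ R).mapMatrix (symP s) * M).trace =
      (s.factorial : ℂ)⁻¹ • ∑ σ : Equiv.Perm (Fin s), ∑ a, M (a ∘ σ) a := by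
  have h : (algebraMap ℂ R).mapMatrix (symP s) =
      (s.factorial : ℂ)⁻¹ • ∑ σ, (algebraMap ℂ R).mapMatrix (permMat s σ) := by
    rw [← map_sum, symP]
    ext a b
    simp only [RingHom.mapMatrix_apply, Matrix.map_apply, Matrix.smul_apply, Matrix.sum_apply,
      smul_eq_mul, map_mul, map_sum, Algebra.smul_def (_ : ℂ) (_ : R)]
  rw [h, Matrix.smul_mul, Matrix.trace_smul, Finset.sum_mul, Matrix.trace_sum,
    ← Equiv.sum_comp (Equiv.inv (Equiv.Perm (Fin s)))]
  congr 1
  refine Finset.sum_congr rfl fun σ _ => ?_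
  simp only [Matrix.trace, Matrix.diag_apply, permMat_mul_apply, Equiv.inv_apply, inv_inv]

end Symmetrizer

section Fused

theorem compRingEquiv_symm_embSym (l N s : ℕ) :
    (Matrix.compRingEquiv (Fin s → Fin 2) (Fin N → Fin (l + 1)) ℂ).symm (embSym l s) =
      (algebraMap ℂ (Matrix (Fin N → Fin (l + 1)) (Fin N → Fin (l + 1)) ℂ)).mapMatrix
        (symP s) := by
  ext a b x y
  rw [RingHom.mapMatrix_apply, Matrix.map_apply, Matrix.algebraMap_matrix_apply]
  change symP s a b * _ = _
  split_ifs <;> simp_all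

theorem compRingEquiv_symm_embA {l N s : ℕ} (j : Fin s)
    (M : Matrix (Fin 2 × (Fin N → Fin (l + 1))) (Fin 2 × (Fin N → Fin (l + 1))) ℂ) :
    (Matrix.compRingEquiv (Fin s → Fin 2) (Fin N → Fin (l + 1)) ℂ).symm (embA l s j M) =
      legOp j ((Matrix.compRingEquiv (Fin 2) (Fin N → Fin (l + 1)) ℂ).symm M) := by
  ext a b x y
  have h := legOp_apply_eq_mul_prod j (Matrix.of fun i k => M (i, x) (k, y)) a b
  change M (a j, x) (b j, y) * _ = _
  rw [← Matrix.of_apply (fun i k => M (i, x) (k, y)) (a j) (b j), ← h]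
  simp only [legOp, Matrix.of_apply]
  split_ifs <;> rfl

/-- The monodromy matrices entering the fusion, with shifted spectral parameters. -/
def fusionSeq (η : ℂ) (l N s : ℕ) (v : ℂ) (n : ℕ) :
    Matrix (Fin 2) (Fin 2) (Matrix (Fin N → Fin (l + 1)) (Fin N → Fin (l + 1)) ℂ) :=
  monodromyBlock η l N (v + ((s : ℂ) - 1 - 2 * (n : ℕ)) * η / 2)

theorem rowSymm_fusionSeq (η : ℂ) (l N s : ℕ) (v : ℂ) (n : ℕ) :
    RowSymm (fusionSeq η l N s v n) (fusionSeq η l N s v (n + 1)) := by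
  have h := rowSymm_monodromyBlock η l N (v + ((s : ℂ) - 1 - 2 * (n : ℕ)) * η / 2)
  rwa [show v + ((s : ℂ) - 1 - 2 * (n : ℕ)) * η / 2 - η =
    v + ((s : ℂ) - 1 - 2 * ((n + 1 : ℕ) : ℂ)) * η / 2 by push_cast; ring] at h

theorem compRingEquiv_symm_Tfus (η : ℂ) (l N s : ℕ) (v : ℂ) :
    (Matrix.compRingEquiv (Fin s → Fin 2) (Fin N → Fin (l + 1)) ℂ).symm (Tfus η l N s v) =
      (algebraMap ℂ _).mapMatrix (symP s) * Matrix.of (wordProd (fusionSeq η l N s v)) *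
        (algebraMap ℂ _).mapMatrix (symP s) := by
  rw [Tfus, map_mul, map_mul, compRingEquiv_symm_embSym]
  congr 2
  rw [List.ofFn_eq_map, map_list_prod, List.map_map]
  simp only [Function.comp_def, compRingEquiv_symm_embA]
  ext1 a b
  rw [prod_legOp_apply _ _ (List.nodup_finRange s), if_pos (by simp), Matrix.of_apply, wordProd,
    List.ofFn_eq_map]
  rfl

theorem tfus_eq_symTr (η : ℂ) (l N s : ℕ) (v : ℂ) :
    tfus η l N s v = symTr s (fusionSeq η l N s v) := by
  have hs : (s.factorial : ℂ) ≠ 0 := Nat.cast_ne_zero.2 (Nat.factorial_ne_zero s)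
  have h : tfus η l N s v = ((Matrix.compRingEquiv (Fin s → Fin 2) (Fin N → Fin (l + 1)) ℂ).symm
      (Tfus η l N s v)).trace := by
    ext x y
    rw [Matrix.trace, Matrix.sum_apply]
    rfl
  rw [h, compRingEquiv_symm_Tfus, ← trace_mapMatrix_mul_comm, ← mul_assoc, ← map_mul,
    symP_mul_symP, trace_symP_mul]
  simp only [Matrix.of_apply]
  rw [sum_perm_wordProd s _ (rowSymm_fusionSeq η l N s v), ← Nat.cast_smul_eq_nsmul ℂ, smul_smul,
    inv_mul_cancel₀ hs, one_smul]

theorem LamFus_eq_snd_symTr (η : ℂ) (l N s : ℕ) (α : Fin 3) (v : ℂ) :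
    LamFus η l N s α v =
      (symTr s fun n => twist (sigmaSpin α) (fusionSeq η l N s v n)).snd := by
  have hs : (s.factorial : ℂ) ≠ 0 := Nat.cast_ne_zero.2 (Nat.factorial_ne_zero s)
  let φ := (Matrix.compRingEquiv (Fin s → Fin 2) (Fin N → Fin (l + 1)) ℂ).symm
  let ρ := (algebraMap ℂ (Matrix (Fin N → Fin (l + 1)) (Fin N → Fin (l + 1)) ℂ)).mapMatrix
    (m := Fin s → Fin 2)
  have h : LamFus η l N s α v =
      (φ ((∑ j : Fin s, embA l s j (e1H l (sigmaSpin α))) * Tfus η l N s v)).trace := by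
    ext x y
    rw [Matrix.trace, Matrix.sum_apply]
    rfl
  have hspin : ∀ j : Fin s, φ (embA l s j (e1H l (sigmaSpin α))) =
      ρ (legOp j (sigmaSpin α)) := by
    intro j
    ext1 a b
    simp only [φ, compRingEquiv_symm_embA, ρ, RingHom.mapMatrix_apply, Matrix.map_apply, legOp,
      Matrix.of_apply]
    split_ifs
    · ext x y
      change sigmaSpin α (a j) (b j) * (if x = y then 1 else 0) = _
      rw [Matrix.algebraMap_matrix_apply]
      split_ifs <;> simp
    · simp
  have hP := (commute_symP_sum_legOp s (sigmaSpin α)).eq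
  let M : Matrix (Fin s → Fin 2) (Fin s → Fin 2)
      (Matrix (Fin N → Fin (l + 1)) (Fin N → Fin (l + 1)) ℂ) :=
    Matrix.of (wordProd (fusionSeq η l N s v))
  have hentry : ∀ a b, (ρ (∑ j : Fin s, legOp j (sigmaSpin α)) * M) a b =
      (wordProd (fun n => twist (sigmaSpin α) (fusionSeq η l N s v n)) a b).snd := by
    intro a b
    have hρ : ∀ j : Fin s, ρ (legOp j (sigmaSpin α)) =
        legOp j ((algebraMap ℂ _).mapMatrix (sigmaSpin α)) := by
      intro j
      ext1 a b
      simp only [ρ, RingHom.mapMatrix_apply, Matrix.map_apply, legOp, Matrix.of_apply]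
      split_ifs <;> simp
    rw [snd_wordProd_twist, map_sum, Finset.sum_mul, Matrix.sum_apply]
    refine Finset.sum_congr rfl fun j _ => ?_
    rw [hρ, legOp_mul_apply]
    simp only [RingHom.mapMatrix_apply, Matrix.map_apply, M, Matrix.of_apply, Algebra.smul_def]
  rw [h, map_mul, map_sum, Finset.sum_congr rfl fun j _ => hspin j, ← map_sum,
    show φ (Tfus η l N s v) = _ from compRingEquiv_symm_Tfus η l N s v, ← mul_assoc, ← mul_assoc,
    ← trace_mapMatrix_mul_comm, ← mul_assoc, ← mul_assoc]
  change (ρ (symP s) * ρ _ * ρ (symP s) * M).trace = _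
  rw [← map_mul, hP, ← map_mul, mul_assoc, symP_mul_symP, ← hP, map_mul,
    mul_assoc, trace_symP_mul]
  simp only [hentry]
  have hsum := congrArg TrivSqZeroExt.snd (sum_perm_wordProd s
    (fun n => twist (sigmaSpin α) (fusionSeq η l N s v n))
    fun n => (rowSymm_fusionSeq η l N s v n).twist _)
  simp only [TrivSqZeroExt.snd_sum, TrivSqZeroExt.snd_smul] at hsum
  rw [hsum, ← Nat.cast_smul_eq_nsmul ℂ, smul_smul, inv_mul_cancel₀ hs, one_smul]

theorem Lam1_eq_snd_trace (η : ℂ) (l N : ℕ) (α : Fin 3) (v : ℂ) :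
    Lam1 η l N α v = (twist (sigmaSpin α) (monodromyBlock η l N v)).trace.snd := by
  rw [Matrix.trace_fin_two, TrivSqZeroExt.snd_add]
  simp only [snd_twist, monodromyBlock_apply, Fin.sum_univ_two]
  fin_cases α
  · simp [Lam1, sigmaSpin]
    module
  · simp [Lam1, sigmaSpin]
  · simp [Lam1, sigmaSpin]

theorem trace_sigmaSpin (α : Fin 3) : (sigmaSpin α).trace = 0 := by
  fin_cases α <;> simp [sigmaSpin, Matrix.trace_fin_two]

end Fused

/-- for `1 ≤ s ≤ l`, the fused quantity `Λ_α^{(s)}(u)` satisfies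
`Λ_α^{(s)}(u) = Σ_{k=1}^s t^{(s−k)}(u+kη/2) · Λ_α^{(1)}(u+(2k−s−1)η/2) · t^{(k−1)}(u+(k−s−1)η/2)`. -/
theorem fused_spin_recursion (η : ℂ) (l : ℕ) (hl : 1 ≤ l) (N : ℕ) (hN : 1 ≤ N)
    (s : ℕ) (hs1 : 1 ≤ s) (hsl : s ≤ l) (α : Fin 3) (u : ℂ) :
    LamFus η l N s α u =
      ∑ k ∈ Finset.Icc 1 s,
        tfus η l N (s - k) (u + (k : ℂ) * η / 2) *
          Lam1 η l N α (u + (2 * (k : ℂ) - (s : ℂ) - 1) * η / 2) *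
          tfus η l N (k - 1) (u + ((k : ℂ) - (s : ℂ) - 1) * η / 2) := by
  rw [LamFus_eq_snd_symTr, snd_symTr_twist _ (trace_sigmaSpin α) s _ (rowSymm_fusionSeq η l N s u)]
  refine Finset.sum_nbij' (fun i => s - i) (fun k => s - k) ?_ ?_ ?_ ?_ ?_
  · intro i hi
    rw [Finset.mem_range] at hi
    rw [Finset.mem_Icc]
    omega
  · intro k hk
    rw [Finset.mem_Icc] at hk
    rw [Finset.mem_range]
    omega
  · intro i hi
    rw [Finset.mem_range] at hi
    omega
  · intro k hk
    rw [Finset.mem_Icc] at hk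
    omega
  · intro i hi
    rw [Finset.mem_range] at hi
    have hsi : s - (s - i) = i := by omega
    have hsi' : s - i - 1 = s - 1 - i := by omega
    have hleft : fusionSeq η l N i (u + ((s - i : ℕ) : ℂ) * η / 2) = fusionSeq η l N s u := by
      funext n
      rw [fusionSeq, fusionSeq, Nat.cast_sub hi.le]
      ring_nf
    have hmid : u + (2 * ((s - i : ℕ) : ℂ) - (s : ℂ) - 1) * η / 2 =
        u + ((s : ℂ) - 1 - 2 * (i : ℕ)) * η / 2 := by
      rw [Nat.cast_sub hi.le]
      ring
    have hright : fusionSeq η l N (s - 1 - i) (u + (((s - i : ℕ) : ℂ) - (s : ℂ) - 1) * η / 2) =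
        fun n => fusionSeq η l N s u (n + (i + 1)) := by
      funext n
      rw [fusionSeq, fusionSeq, Nat.cast_sub (by omega : i ≤ s - 1), Nat.cast_sub hs1,
        Nat.cast_sub hi.le]
      push_cast
      ring_nf
    rw [hsi, hsi', tfus_eq_symTr, tfus_eq_symTr, Lam1_eq_snd_trace, hleft, hmid, hright]
    rfl
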